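/- Let (Q,ρ) be a directed set of states and < a total order on Q. Then the set tlmon(Q,ρ,<) of transitions that are both deterministic and planar with respect to ρ and < is a submonoid of the monoid B(Q,ρ) of all transitions under gluing composition, and this submonoid is aperiodic. -/

import Mathlib

namespace Planar2DFT

/-- Tape alphabet: input letters plus the two endmarkers `▷` and `◁`. -/
inductive Tape (A : Type) where
  | lend : Tape A
  | rend : Tape A
  | sym  : A → Tape A

/-- Edges of the transition profile `G(ρ, f)` on vertices `Q × Bool`
(`true` codes direction `+1`, `false` codes `-1`): an edge
`(q, -ρ q) → (r, ρ r)` for every `(q, r) ∈ f`. -/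
def ProfileEdge {Q : Type} (ρ : Q → Bool) (f : Set (Q × Q)) :
    Q × Bool → Q × Bool → Prop :=
  fun u v => ∃ p ∈ f, u = (p.1, !ρ p.1) ∧ v = (p.2, ρ p.2)

/-- The extension of a strict order on `Q` to `Q × Bool`:
`(q,i) < (r,j)` iff (`i = -1` and `j = 1`), or (`q < r` and `i = j = 1`),
or (`q > r` and `i = j = -1`). -/
def ExtLt {Q : Type} (lt : Q → Q → Prop) : Q × Bool → Q × Bool → Prop :=
  fun x y =>
    (x.2 = false ∧ y.2 = true) ∨
    (lt x.1 y.1 ∧ x.2 = true ∧ y.2 = true) ∨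
    (lt y.1 x.1 ∧ x.2 = false ∧ y.2 = false)

/-- Planarity of a transition w.r.t. a direction map `ρ` and a strict total
order `lt`: no vertices `u < r < v < s` with an edge between `u` and `v`
(in either direction) and an edge between `r` and `s` (in either direction). -/
def IsPlanar {Q : Type} (ρ : Q → Bool) (lt : Q → Q → Prop) (f : Set (Q × Q)) : Prop :=
  ¬ ∃ u r v s : Q × Bool, ExtLt lt u r ∧ ExtLt lt r v ∧ ExtLt lt v s ∧
      (ProfileEdge ρ f u v ∨ ProfileEdge ρ f v u) ∧
      (ProfileEdge ρ f r s ∨ ProfileEdge ρ f s r)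

/-- Deterministic transition: a partial function. -/
def IsDet {Q : Type} (f : Set (Q × Q)) : Prop :=
  ∀ q r r', (q, r) ∈ f → (q, r') ∈ f → r = r'

/-- Reversible transition: a partial injection. -/
def IsRev {Q : Type} (f : Set (Q × Q)) : Prop :=
  IsDet f ∧ ∀ q q' r, (q, r) ∈ f → (q', r) ∈ f → q = q'

/-- Edges of the glued graph `C(ρ, f, g)` on `Q × Fin 3`, levels `0, 1, 2`
coding `-1, 0, 1`: the copy of `G(ρ,f)` lives on levels `{0,1}` (side `+1`
corresponding to level `1`) and the copy of `G(ρ,g)` on levels `{1,2}`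
(side `+1` corresponding to level `2`). -/
def GlueEdge {Q : Type} (ρ : Q → Bool) (f g : Set (Q × Q)) :
    Q × Fin 3 → Q × Fin 3 → Prop :=
  fun x y =>
    (x.2 ≠ 2 ∧ y.2 ≠ 2 ∧
      ProfileEdge ρ f (x.1, decide (x.2 = 1)) (y.1, decide (y.2 = 1))) ∨
    (x.2 ≠ 0 ∧ y.2 ≠ 0 ∧
      ProfileEdge ρ g (x.1, decide (x.2 = 2)) (y.1, decide (y.2 = 2)))

/-- Gluing composition `f * g` of transitions: `(q, r) ∈ f * g` iff there is a
directed path from `(q, -ρ q)` to `(r, ρ r)` in the glued graph `C(ρ, f, g)`. -/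
def glue {Q : Type} (ρ : Q → Bool) (f g : Set (Q × Q)) : Set (Q × Q) :=
  {p | Relation.ReflTransGen (GlueEdge ρ f g)
        (p.1, if ρ p.1 then (0 : Fin 3) else 2)
        (p.2, if ρ p.2 then (2 : Fin 3) else 0)}

/-- The identity transition, unit of the gluing composition. -/
def idRel (Q : Type) : Set (Q × Q) := {p | p.1 = p.2}

/-- Iterated gluing powers of a transition, with `glpow ρ f 0 = idRel Q`. -/
def glpow {Q : Type} (ρ : Q → Bool) (f : Set (Q × Q)) : ℕ → Set (Q × Q)
  | 0 => idRel Q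
  | n + 1 => glue ρ (glpow ρ f n) f

/-- A configuration of a two-way machine: the tape content to the left of the
head, the current state, and the tape content to the right of the head. -/
abbrev Config (Q A : Type) := List (Tape A) × Q × List (Tape A)

/-- The tape encoding `▷ u ◁` of an input word `u`. -/
def tapeOf {A : Type} (u : List A) : List (Tape A) :=
  Tape.lend :: (u.map Tape.sym ++ [Tape.rend])

/-- A two-way (nondeterministic) finite transducer. -/
structure TwoWayTransducer (Q A B : Type) where
  ρ : Q → Bool
  init : Q
  init_fwd : ρ init = true
  final : Set Q
  δ : Tape A → Set (Q × List B × Q)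

namespace TwoWayTransducer

variable {Q A B : Type}

/-- The transitions `⌊δ⌋(a)` of the underlying automaton. -/
def rel (T : TwoWayTransducer Q A B) (a : Tape A) : Set (Q × Q) :=
  {p | ∃ w, (p.1, w, p.2) ∈ T.δ a}

def Deterministic (T : TwoWayTransducer Q A B) : Prop :=
  ∀ a, IsDet (T.rel a)

def Reversible (T : TwoWayTransducer Q A B) : Prop :=
  ∀ a, IsRev (T.rel a)

def Planar (T : TwoWayTransducer Q A B) : Prop :=
  ∃ lt : Q → Q → Prop, IsStrictTotalOrder Q lt ∧
    ∀ a : A, IsPlanar T.ρ lt (T.rel (Tape.sym a))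

/-- One step of the two-way transducer, labelled by the output word. -/
def Step (T : TwoWayTransducer Q A B) (c : Config Q A) (w : List B)
    (c' : Config Q A) : Prop :=
  ∃ a u v q r, (q, w, r) ∈ T.δ a ∧
    ((T.ρ q = true ∧ T.ρ r = true ∧ c = (u, q, a :: v) ∧ c' = (u ++ [a], r, v)) ∨
     (T.ρ q = true ∧ T.ρ r = false ∧ c = (u, q, a :: v) ∧ c' = (u, r, a :: v)) ∨
     (T.ρ q = false ∧ T.ρ r = false ∧ c = (u ++ [a], q, v) ∧ c' = (u, r, a :: v)) ∨
     (T.ρ q = false ∧ T.ρ r = true ∧ c = (u ++ [a], q, v) ∧ c' = (u ++ [a], r, v)))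

/-- Multi-step runs, accumulating the concatenated output. -/
inductive Run (T : TwoWayTransducer Q A B) : Config Q A → List B → Config Q A → Prop
  | refl (c : Config Q A) : Run T c [] c
  | step {c₁ w₁ c₂ w₂ c₃} : Run T c₁ w₁ c₂ → T.Step c₂ w₂ c₃ → Run T c₁ (w₁ ++ w₂) c₃

/-- The pair `(u, v)` is realized by `T`. -/
def Realizes (T : TwoWayTransducer Q A B) (u : List A) (v : List B) : Prop :=
  ∃ qf ∈ T.final, T.Run ([], T.init, tapeOf u) v (tapeOf u, qf, [])

/-- `T` computes the partial function `f`. -/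
def Computes (T : TwoWayTransducer Q A B) (f : List A → Option (List B)) : Prop :=
  ∀ u v, f u = some v ↔ T.Realizes u v

end TwoWayTransducer

/-- Membership in the least submonoid of `B(Q,ρ)` containing the transitions
`⌊δ⌋(a)` for the input letters `a`. -/
inductive InBehav {Q A B : Type} (T : TwoWayTransducer Q A B) : Set (Q × Q) → Prop
  | one : InBehav T (idRel Q)
  | gen (a : A) : InBehav T (T.rel (Tape.sym a))
  | mul {f g} : InBehav T f → InBehav T g → InBehav T (glue T.ρ f g)

/-- The behaviour monoid `B(T)` is aperiodic. -/
def ApBehav {Q A B : Type} (T : TwoWayTransducer Q A B) : Prop :=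
  ∃ n : ℕ, ∀ f, InBehav T f → glpow T.ρ f (n + 1) = glpow T.ρ f n

/-- A first-order transduction: a partial function computed by some
deterministic two-way transducer whose behaviour monoid is aperiodic. -/
def IsFOTransduction {A B : Type} (f : List A → Option (List B)) : Prop :=
  ∃ (n : ℕ) (T : TwoWayTransducer (Fin n) A B),
    T.Deterministic ∧ ApBehav T ∧ T.Computes f

/-- A two-way (nondeterministic) finite automaton. -/
structure TwoWayAutomaton (Q A : Type) where
  ρ : Q → Bool
  init : Q
  init_fwd : ρ init = true
  final : Set Q
  δ : Tape A → Set (Q × Q)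

namespace TwoWayAutomaton

variable {Q A : Type}

def Deterministic (M : TwoWayAutomaton Q A) : Prop := ∀ a, IsDet (M.δ a)

def Reversible (M : TwoWayAutomaton Q A) : Prop := ∀ a, IsRev (M.δ a)

def Planar (M : TwoWayAutomaton Q A) : Prop :=
  ∃ lt : Q → Q → Prop, IsStrictTotalOrder Q lt ∧
    ∀ a : A, IsPlanar M.ρ lt (M.δ (Tape.sym a))

/-- One step of the two-way automaton. -/
def Step (M : TwoWayAutomaton Q A) (c c' : Config Q A) : Prop :=
  ∃ a u v q r, (q, r) ∈ M.δ a ∧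
    ((M.ρ q = true ∧ M.ρ r = true ∧ c = (u, q, a :: v) ∧ c' = (u ++ [a], r, v)) ∨
     (M.ρ q = true ∧ M.ρ r = false ∧ c = (u, q, a :: v) ∧ c' = (u, r, a :: v)) ∨
     (M.ρ q = false ∧ M.ρ r = false ∧ c = (u ++ [a], q, v) ∧ c' = (u, r, a :: v)) ∨
     (M.ρ q = false ∧ M.ρ r = true ∧ c = (u ++ [a], q, v) ∧ c' = (u ++ [a], r, v)))

def Accepts (M : TwoWayAutomaton Q A) (u : List A) : Prop :=
  ∃ qf ∈ M.final, Relation.ReflTransGen M.Step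
    ([], M.init, tapeOf u) (tapeOf u, qf, [])

def Language (M : TwoWayAutomaton Q A) : Set (List A) := {u | M.Accepts u}

end TwoWayAutomaton

/-- The underlying automaton `⌊T⌋` of a transducer `T`. -/
def forget {Q A B : Type} (T : TwoWayTransducer Q A B) : TwoWayAutomaton Q A :=
  { ρ := T.ρ, init := T.init, init_fwd := T.init_fwd, final := T.final,
    δ := fun a => T.rel a }

/-- Star-free languages: the smallest class containing all finite languages
and closed under finite union, complement and concatenation. -/
inductive StarFree {A : Type} : Set (List A) → Prop
  | of_finite (L : Set (List A)) : L.Finite → StarFree L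
  | union {L M : Set (List A)} : StarFree L → StarFree M → StarFree (L ∪ M)
  | compl {L : Set (List A)} : StarFree L → StarFree Lᶜ
  | concat {L M : Set (List A)} : StarFree L → StarFree M →
      StarFree {w | ∃ u ∈ L, ∃ v ∈ M, w = u ++ v}

/-- A (total, deterministic) sequential transducer. -/
structure SeqTransducer (Q A B : Type) where
  init : Q
  next : A → Q → Q
  out : A → Q → List B
  fin : Q → List B

namespace SeqTransducer

variable {Q A B : Type}

/-- Running a sequential transducer on a word from a state: final state and
produced output. -/
def run (T : SeqTransducer Q A B) : List A → Q → Q × List B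
  | [], q => (q, [])
  | a :: w, q =>
      let p := run T w (T.next a q)
      (p.1, T.out a q ++ p.2)

/-- The (total) sequential function computed by a sequential transducer. -/
def fn (T : SeqTransducer Q A B) (w : List A) : List B :=
  (T.run w T.init).2 ++ T.fin (T.run w T.init).1

end SeqTransducer

/-- Membership in the transition monoid of a sequential transducer, i.e. the
monoid of functions `Q → Q` generated by the `∂₁(a)`. -/
inductive SeqGen {Q A B : Type} (T : SeqTransducer Q A B) : (Q → Q) → Prop
  | id : SeqGen T id
  | gen (a : A) : SeqGen T (T.next a)
  | comp {h h'} : SeqGen T h → SeqGen T h' → SeqGen T (h ∘ h')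

/-- A sequential transducer is aperiodic when its transition monoid is. -/
def SeqTransducer.Aperiodic {Q A B : Type} (T : SeqTransducer Q A B) : Prop :=
  ∃ n : ℕ, ∀ h, SeqGen T h → h^[n + 1] = h^[n]



section Proof

open Relation

variable {Q : Type}

/-- Gap from which state `q` enters cell `k`. -/
def srcGap (ρ : Q → Bool) (q : Q) (k : ℕ) : ℕ := if ρ q then k else k + 1

/-- Gap at which state `q` leaves cell `k`. -/
def tgtGap (ρ : Q → Bool) (q : Q) (k : ℕ) : ℕ := if ρ q then k + 1 else k

/-- One step of a run on the cells `a, …, b-1` of a strip. -/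
def SStep (ρ : Q → Bool) (c : ℕ → Set (Q × Q)) (a b : ℕ) (x y : Q × ℕ) : Prop :=
  ∃ k, a ≤ k ∧ k < b ∧ (x.1, y.1) ∈ c k ∧ x.2 = srcGap ρ x.1 k ∧ y.2 = tgtGap ρ y.1 k

/-- Transition of the strip of cells `a, …, b-1`. -/
def Str (ρ : Q → Bool) (c : ℕ → Set (Q × Q)) (a b : ℕ) : Set (Q × Q) :=
  {p | ReflTransGen (SStep ρ c a b)
        (p.1, if ρ p.1 then a else b) (p.2, if ρ p.2 then b else a)}

lemma SStep.mono {ρ : Q → Bool} {c : ℕ → Set (Q × Q)} {a b a' b' : ℕ} (ha : a' ≤ a) (hb : b ≤ b')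
    {x y : Q × ℕ} (h : SStep ρ c a b x y) : SStep ρ c a' b' x y := by
  obtain ⟨k, h1, h2, h3⟩ := h
  exact ⟨k, ha.trans h1, h2.trans_le hb, h3⟩

lemma SStep.bounds {ρ : Q → Bool} {c : ℕ → Set (Q × Q)} {a b : ℕ}
    {x y : Q × ℕ} (h : SStep ρ c a b x y) : a ≤ y.2 ∧ y.2 ≤ b := by
  obtain ⟨k, h1, h2, h3, h4, h5⟩ := h
  unfold tgtGap at h5
  split_ifs at h5 <;> omega

lemma sstep_bounds {ρ : Q → Bool} {c : ℕ → Set (Q × Q)} {a b : ℕ}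
    {x y : Q × ℕ} (h : ReflTransGen (SStep ρ c a b) x y) (hx : a ≤ x.2 ∧ x.2 ≤ b) :
    a ≤ y.2 ∧ y.2 ≤ b := by
  induction h with
  | refl => exact hx
  | tail _ h _ => exact h.bounds

lemma sstep_det {ρ : Q → Bool} {c : ℕ → Set (Q × Q)} {a b : ℕ} (hc : ∀ k, IsDet (c k)) :
    Relator.RightUnique (SStep ρ c a b) := by
  rintro ⟨x, i⟩ ⟨y, j⟩ ⟨z, l⟩ ⟨k, h1, h2, h3, h4, h5⟩ ⟨k', h1', h2', h3', h4', h5'⟩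
  have hk : k = k' := by
    simp only [srcGap] at h4 h4'
    split_ifs at h4 h4' <;> omega
  subst hk
  have := hc k _ _ _ h3 h3'
  simp only at this h5 h5'
  subst this
  simp [h5, h5']

lemma sstep_terminal {ρ : Q → Bool} {c : ℕ → Set (Q × Q)} {a b : ℕ} {r : Q} {y : Q × ℕ} :
    ¬ SStep ρ c a b (r, if ρ r then b else a) y := by
  rintro ⟨k, h1, h2, h3, h4, h5⟩
  simp only [srcGap] at h4
  split_ifs at h4 <;> omega

lemma sstep_terminal_eq {ρ : Q → Bool} {c : ℕ → Set (Q × Q)} {a b : ℕ} {r : Q} {y : Q × ℕ}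
    (h : ReflTransGen (SStep ρ c a b) (r, if ρ r then b else a) y) :
    y = (r, if ρ r then b else a) := by
  rcases h.cases_head with h | ⟨z, h, _⟩
  · exact h.symm
  · exact absurd h sstep_terminal

lemma sstep_end_unique {ρ : Q → Bool} {c : ℕ → Set (Q × Q)} {a b : ℕ} (hc : ∀ k, IsDet (c k))
    {x : Q × ℕ} {r r' : Q} 
    (h : ReflTransGen (SStep ρ c a b) x (r, if ρ r then b else a))
    (h' : ReflTransGen (SStep ρ c a b) x (r', if ρ r' then b else a)) : r = r' := by
  rcases ReflTransGen.total_of_right_unique (sstep_det hc) h h' with h | h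
  · exact (congrArg Prod.fst (sstep_terminal_eq h)).symm
  · exact (congrArg Prod.fst (sstep_terminal_eq h))

lemma str_det {ρ : Q → Bool} {c : ℕ → Set (Q × Q)} {a b : ℕ} (hc : ∀ k, IsDet (c k)) :
    IsDet (Str ρ c a b) := fun _ _ _ h h' => sstep_end_unique hc h h'

lemma str_one {ρ : Q → Bool} {c : ℕ → Set (Q × Q)} {k : ℕ} : Str ρ c k (k + 1) = c k := by
  ext ⟨q, r⟩
  constructor
  · intro h
    rcases ReflTransGen.cases_head h with h | ⟨⟨z, j⟩, h, h'⟩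
    · simp only [Prod.mk.injEq] at h
      obtain ⟨rfl, h⟩ := h
      split_ifs at h <;> omega
    · obtain ⟨l, h1, h2, h3, h4, h5⟩ := h
      obtain rfl : l = k := by omega
      simp only at h5
      have e : j = if ρ z then l + 1 else l := h5
      subst e
      have := sstep_terminal_eq h'
      simp only [Prod.mk.injEq] at this
      rw [this.1]
      exact h3
  · intro h
    exact ReflTransGen.single ⟨k, le_rfl, Nat.lt_succ_self k, h, rfl, rfl⟩

lemma str_nil {ρ : Q → Bool} {c : ℕ → Set (Q × Q)} {k : ℕ} : Str ρ c k k = idRel Q := by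
  ext ⟨q, r⟩
  constructor
  · intro h
    rcases ReflTransGen.cases_head h with h | ⟨⟨z, j⟩, h, h'⟩
    · exact congrArg Prod.fst h
    · obtain ⟨l, h1, h2, h3, h4, h5⟩ := h
      omega
  · intro h
    obtain rfl : q = r := h
    simp only [Str, Set.mem_ofPred_eq, ite_self]
    exact ReflTransGen.refl

/-- Level of a glued graph as a gap. -/
def lev (a m b : ℕ) (i : Fin 3) : ℕ := if i = 0 then a else if i = 1 then m else b

lemma glueEdge_left {ρ : Q → Bool} {X Y : Set (Q × Q)} {p r : Q} (h : (p, r) ∈ X) :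
    GlueEdge ρ X Y (p, if ρ p then 0 else 1) (r, if ρ r then 1 else 0) := by
  refine Or.inl ⟨?_, ?_, (p, r), h, ?_, ?_⟩
  all_goals first | (by_cases hp : ρ p <;> simp [hp]; done) | (by_cases hp : ρ r <;> simp [hp])

lemma glueEdge_right {ρ : Q → Bool} {X Y : Set (Q × Q)} {p r : Q} (h : (p, r) ∈ Y) :
    GlueEdge ρ X Y (p, if ρ p then 1 else 2) (r, if ρ r then 2 else 1) := by
  refine Or.inr ⟨?_, ?_, (p, r), h, ?_, ?_⟩
  all_goals first | (by_cases hp : ρ p <;> simp [hp]; done) | (by_cases hp : ρ r <;> simp [hp])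

lemma glueEdge_cases {ρ : Q → Bool} {X Y : Set (Q × Q)} {x y : Q × Fin 3}
    (h : GlueEdge ρ X Y x y) :
    ((x.1, y.1) ∈ X ∧ x.2 = (if ρ x.1 then 0 else 1) ∧ y.2 = (if ρ y.1 then 1 else 0)) ∨
    ((x.1, y.1) ∈ Y ∧ x.2 = (if ρ x.1 then 1 else 2) ∧ y.2 = (if ρ y.1 then 2 else 1)) := by
  obtain ⟨x, i⟩ := x
  obtain ⟨y, j⟩ := y
  rcases h with ⟨h1, h2, ⟨p, r⟩, hp, e1, e2⟩ | ⟨h1, h2, ⟨p, r⟩, hp, e1, e2⟩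
  · left
    simp only [Prod.mk.injEq] at e1 e2
    obtain ⟨rfl, e1⟩ := e1
    obtain ⟨rfl, e2⟩ := e2
    refine ⟨hp, ?_, ?_⟩
    · revert e1 h1; cases ρ x <;> fin_cases i <;> simp
    · revert e2 h2; cases ρ y <;> fin_cases j <;> simp
  · right
    simp only [Prod.mk.injEq] at e1 e2
    obtain ⟨rfl, e1⟩ := e1
    obtain ⟨rfl, e2⟩ := e2
    refine ⟨hp, ?_, ?_⟩
    · revert e1 h1; cases ρ x <;> fin_cases i <;> simp
    · revert e2 h2; cases ρ y <;> fin_cases j <;> simp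

lemma glue_str_sub {ρ : Q → Bool} {c : ℕ → Set (Q × Q)} {a m b : ℕ} (ham : a ≤ m) (hmb : m ≤ b) :
    glue ρ (Str ρ c a m) (Str ρ c m b) ⊆ Str ρ c a b := by
  rintro ⟨q, r⟩ h
  have key : ∀ x y : Q × Fin 3, GlueEdge ρ (Str ρ c a m) (Str ρ c m b) x y →
      ReflTransGen (SStep ρ c a b) (x.1, lev a m b x.2) (y.1, lev a m b y.2) := by
    rintro ⟨x, i⟩ ⟨y, j⟩ h
    rcases glueEdge_cases h with ⟨h1, h2, h3⟩ | ⟨h1, h2, h3⟩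
    · simp only at h1 h2 h3
      have := ReflTransGen.mono (fun _ _ => SStep.mono le_rfl hmb) _ _ h1
      convert this using 2
      · simp only [h2]; cases hq : ρ x <;> simp [lev]
      · simp only [h3]; cases hq : ρ y <;> simp [lev]
    · simp only at h1 h2 h3
      have := ReflTransGen.mono (fun _ _ => SStep.mono ham le_rfl) _ _ h1
      convert this using 2
      · simp only [h2]; cases hq : ρ x <;> simp [lev]
      · simp only [h3]; cases hq : ρ y <;> simp [lev]
  have := ReflTransGen.lift' (fun x : Q × Fin 3 => (x.1, lev a m b x.2)) key _ _ h
  simp only [Str, Set.mem_ofPred_eq]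
  convert this using 2
  · cases ρ q <;> simp [lev]
  · cases ρ r <;> simp [lev]

lemma str_sub_glue {ρ : Q → Bool} {c : ℕ → Set (Q × Q)} {a m b : ℕ} (ham : a ≤ m) (hmb : m ≤ b) :
    Str ρ c a b ⊆ glue ρ (Str ρ c a m) (Str ρ c m b) := by
  rintro ⟨q, r⟩ h
  have inv : ∀ y : Q × ℕ, ReflTransGen (SStep ρ c a b) (q, if ρ q then a else b) y →
      (∃ p, ReflTransGen (GlueEdge ρ (Str ρ c a m) (Str ρ c m b))
          (q, if ρ q then 0 else 2) (p, if ρ p then 0 else 1) ∧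
          ReflTransGen (SStep ρ c a m) (p, if ρ p then a else m) y) ∨
      (∃ p, ReflTransGen (GlueEdge ρ (Str ρ c a m) (Str ρ c m b))
          (q, if ρ q then 0 else 2) (p, if ρ p then 1 else 2) ∧
          ReflTransGen (SStep ρ c m b) (p, if ρ p then m else b) y) := by
    intro y hy
    induction hy with
    | refl =>
      cases hq : ρ q
      · right
        refine ⟨q, ?_, ?_⟩ <;> simp [hq] <;> exact ReflTransGen.refl
      · left
        refine ⟨q, ?_, ?_⟩ <;> simp [hq] <;> exact ReflTransGen.refl
    | @tail y z hy hyz ih =>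
      obtain ⟨y, i⟩ := y
      obtain ⟨k, h1, h2, h3, h4, h5⟩ := hyz
      simp only at h3 h4 h5
      by_cases hk : k < m
      · have st : SStep ρ c a m (y, i) z := ⟨k, h1, hk, h3, h4, h5⟩
        left
        rcases ih with ⟨p, hp, hpy⟩ | ⟨p, hp, hpy⟩
        · exact ⟨p, hp, hpy.tail st⟩
        · have hb := sstep_bounds hpy (by constructor <;> simp only <;> split_ifs <;> omega)
          simp only at hb
          simp only [srcGap] at h4
          cases hρ : ρ y
          · simp only [hρ] at h4
            have hi : i = m := by simp at h4; omega
            subst hi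
            have hY : (p, y) ∈ Str ρ c i b := by
              simp only [Str, Set.mem_ofPred_eq, hρ]
              simpa using hpy
            refine ⟨y, hp.tail ?_, ReflTransGen.single ?_⟩
            · have := glueEdge_right (ρ := ρ) (X := Str ρ c a i) hY
              simpa [hρ] using this
            · simpa [hρ] using st
          · simp [hρ] at h4; omega
      · have st : SStep ρ c m b (y, i) z := ⟨k, by omega, h2, h3, h4, h5⟩
        right
        rcases ih with ⟨p, hp, hpy⟩ | ⟨p, hp, hpy⟩
        · have hb := sstep_bounds hpy (by constructor <;> simp only <;> split_ifs <;> omega)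
          simp only at hb
          simp only [srcGap] at h4
          cases hρ : ρ y
          · simp [hρ] at h4; omega
          · simp only [hρ] at h4
            have hi : i = m := by simp at h4; omega
            subst hi
            have hY : (p, y) ∈ Str ρ c a i := by
              simp only [Str, Set.mem_ofPred_eq, hρ]
              simpa using hpy
            refine ⟨y, hp.tail ?_, ReflTransGen.single ?_⟩
            · have := glueEdge_left (ρ := ρ) (Y := Str ρ c i b) hY
              simpa [hρ] using this
            · simpa [hρ] using st
        · exact ⟨p, hp, hpy.tail st⟩
  have hend := inv _ h
  simp only at hend
  show ReflTransGen _ _ _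
  simp only
  rcases hend with ⟨p, hp, hpy⟩ | ⟨p, hp, hpy⟩
  · have hb := sstep_bounds hpy (by constructor <;> simp only <;> split_ifs <;> omega)
    simp only at hb
    cases hρ : ρ r
    · have hX : (p, r) ∈ Str ρ c a m := by
        simp only [Str, Set.mem_ofPred_eq, hρ]
        simpa [hρ] using hpy
      refine hp.tail ?_
      have := glueEdge_left (ρ := ρ) (Y := Str ρ c m b) hX
      simpa [hρ] using this
    · simp [hρ] at hb
      obtain rfl : m = b := by omega
      have hX : (p, r) ∈ Str ρ c a m := by
        simp only [Str, Set.mem_ofPred_eq, hρ]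
        simpa [hρ] using hpy
      have hY : (r, r) ∈ Str ρ c m m := by rw [str_nil]; rfl
      have e1 := glueEdge_left (ρ := ρ) (Y := Str ρ c m m) hX
      have e2 := glueEdge_right (ρ := ρ) (X := Str ρ c a m) hY
      simp only [hρ, if_true] at e1 e2 ⊢
      exact (hp.tail e1).tail e2
  · have hb := sstep_bounds hpy (by constructor <;> simp only <;> split_ifs <;> omega)
    simp only at hb
    cases hρ : ρ r
    · simp [hρ] at hb
      obtain rfl : m = a := by omega
      have hX : (p, r) ∈ Str ρ c m b := by
        simp only [Str, Set.mem_ofPred_eq, hρ]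
        simpa [hρ] using hpy
      have hY : (r, r) ∈ Str ρ c m m := by rw [str_nil]; rfl
      have e1 := glueEdge_right (ρ := ρ) (X := Str ρ c m m) hX
      have e2 := glueEdge_left (ρ := ρ) (Y := Str ρ c m b) hY
      simp [hρ] at e1 e2 ⊢
      exact (hp.tail e1).tail e2
    · have hX : (p, r) ∈ Str ρ c m b := by
        simp only [Str, Set.mem_ofPred_eq, hρ]
        simpa [hρ] using hpy
      refine hp.tail ?_
      have := glueEdge_right (ρ := ρ) (X := Str ρ c a m) hX
      simpa [hρ] using this

lemma glue_str {ρ : Q → Bool} {c : ℕ → Set (Q × Q)} {a m b : ℕ} (ham : a ≤ m) (hmb : m ≤ b) :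
    glue ρ (Str ρ c a m) (Str ρ c m b) = Str ρ c a b :=
  Set.Subset.antisymm (glue_str_sub ham hmb) (str_sub_glue ham hmb)

lemma glue_eq_str {ρ : Q → Bool} (f g : Set (Q × Q)) :
    glue ρ f g = Str ρ (fun k => if k = 0 then f else g) 0 2 := by
  have h := glue_str (ρ := ρ) (c := fun k => if k = 0 then f else g)
    (a := 0) (m := 1) (b := 2) (by omega) (by omega)
  rw [← h]
  have h1 := str_one (ρ := ρ) (c := fun k => if k = 0 then f else g) (k := 0)
  have h2 := str_one (ρ := ρ) (c := fun k => if k = 0 then f else g) (k := 1)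
  simp only [zero_add] at h1
  rw [h1, h2]
  simp

lemma glpow_eq_str {ρ : Q → Bool} (f : Set (Q × Q)) (n : ℕ) :
    glpow ρ f n = Str ρ (fun _ => f) 0 n := by
  induction n with
  | zero => rw [str_nil]; rfl
  | succ n ih =>
    rw [← glue_str (Nat.zero_le n) (Nat.le_succ n), str_one, ← ih]
    rfl

lemma str_shift {ρ : Q → Bool} (f : Set (Q × Q)) (a b : ℕ) :
    Str ρ (fun _ => f) (a + 1) (b + 1) = Str ρ (fun _ => f) a b := by
  ext ⟨q, r⟩
  constructor
  · intro h
    have := ReflTransGen.lift (p := SStep ρ (fun _ => f) a b)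
      (fun x : Q × ℕ => (x.1, x.2 - 1)) ?_ _ _ h
    · show ReflTransGen _ _ _
      convert this using 2
      · simp only; split_ifs <;> omega
      · simp only; split_ifs <;> omega
    · rintro ⟨x, i⟩ ⟨y, j⟩ ⟨k, h1, h2, h3, h4, h5⟩
      refine ⟨k - 1, by omega, by omega, h3, ?_, ?_⟩
      · simp only [srcGap] at h4 ⊢
        split_ifs at h4 ⊢ <;> omega
      · simp only [tgtGap] at h5 ⊢
        split_ifs at h5 ⊢ <;> omega
  · intro h
    have := ReflTransGen.lift (p := SStep ρ (fun _ => f) (a + 1) (b + 1))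
      (fun x : Q × ℕ => (x.1, x.2 + 1)) ?_ _ _ h
    · show ReflTransGen _ _ _
      convert this using 2
      · simp only; split_ifs <;> omega
      · simp only; split_ifs <;> omega
    · rintro ⟨x, i⟩ ⟨y, j⟩ ⟨k, h1, h2, h3, h4, h5⟩
      refine ⟨k + 1, by omega, by omega, h3, ?_, ?_⟩
      · simp only [srcGap] at h4 ⊢
        split_ifs at h4 ⊢ <;> omega
      · simp only [tgtGap] at h5 ⊢
        split_ifs at h5 ⊢ <;> omega

lemma glpow_succ' {ρ : Q → Bool} (f : Set (Q × Q)) (n : ℕ) :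
    glpow ρ f (n + 1) = glue ρ f (glpow ρ f n) := by
  rw [glpow_eq_str, glpow_eq_str, ← glue_str (Nat.zero_le 1) (Nat.le_add_left 1 n)]
  have h1 := str_one (ρ := ρ) (c := fun _ => f) (k := 0)
  simp only [zero_add] at h1
  have h2 := str_shift (ρ := ρ) f 0 n
  simp only [zero_add] at h2
  rw [h1, h2]

lemma glue_mirror_sub (ρ : Q → Bool) (f g : Set (Q × Q)) :
    glue ρ f g ⊆ glue (fun q => !ρ q) g f := by
  rintro ⟨q, r⟩ h
  have := ReflTransGen.lift (p := GlueEdge (fun q => !ρ q) g f)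
    (fun x : Q × Fin 3 => (x.1, Fin.rev x.2)) ?_ _ _ h
  · show ReflTransGen _ _ _
    convert this using 2
    · cases hq : ρ q <;> simp [hq] <;> decide
    · cases hr : ρ r <;> simp [hr] <;> decide
  · rintro ⟨x, i⟩ ⟨y, j⟩ h
    rcases glueEdge_cases h with ⟨h1, h2, h3⟩ | ⟨h1, h2, h3⟩
    · simp only at h1 h2 h3
      have := glueEdge_right (ρ := fun q => !ρ q) (X := g) h1
      convert this using 2
      · simp only [h2]; cases hq : ρ x <;> simp [hq] <;> decide
      · simp only [h3]; cases hq : ρ y <;> simp [hq] <;> decide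
    · simp only at h1 h2 h3
      have := glueEdge_left (ρ := fun q => !ρ q) (Y := f) h1
      convert this using 2
      · simp only [h2]; cases hq : ρ x <;> simp [hq] <;> decide
      · simp only [h3]; cases hq : ρ y <;> simp [hq] <;> decide

lemma glue_mirror (ρ : Q → Bool) (f g : Set (Q × Q)) :
    glue (fun q => !ρ q) g f = glue ρ f g := by
  refine Set.Subset.antisymm ?_ (glue_mirror_sub ρ f g)
  have := glue_mirror_sub (fun q => !ρ q) g f
  simpa using this

end Proof

section Planarity

open Relation

variable {Q : Type}

/-- Parity indicator: `v` lies in the same column as `w` and above `w`. -/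
def sg {ι : Type} [DecidableEq ι] (rk : Q → ℕ) (w v : Q × ι) : ZMod 2 :=
  if w.2 = v.2 ∧ rk w.1 < rk v.1 then 1 else 0

lemma exists_rank [Fintype Q] (lt : Q → Q → Prop) [IsStrictTotalOrder Q lt] :
    ∃ rk : Q → ℕ, ∀ x y, lt x y ↔ rk x < rk y := by
  classical
  let _ := linearOrderOfSTO lt
  refine ⟨fun x => ((Fintype.orderIsoFinOfCardEq Q rfl).symm x : Fin _).val, fun x y => ?_⟩
  rw [← Fin.lt_def, OrderIso.lt_iff_lt]
  rfl

lemma rank_inj {lt : Q → Q → Prop} [IsStrictTotalOrder Q lt] {rk : Q → ℕ}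
    (hrk : ∀ x y, lt x y ↔ rk x < rk y) {x y : Q} (h : rk x = rk y) : x = y := by
  rcases trichotomous_of lt x y with h' | h' | h'
  · rw [hrk] at h'; omega
  · exact h'
  · rw [hrk] at h'; omega

lemma sum_cross {lt : Q → Q → Prop} {rk : Q → ℕ}
    (hrk : ∀ x y, lt x y ↔ rk x < rk y) {u r v s : Q × Bool}
    (h1 : ExtLt lt u r) (h2 : ExtLt lt r v) (h3 : ExtLt lt v s) :
    sg rk r u + sg rk r v + sg rk s u + sg rk s v ≠ 0 := by
  obtain ⟨u, i⟩ := u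
  obtain ⟨r, j⟩ := r
  obtain ⟨v, k⟩ := v
  obtain ⟨s, l⟩ := s
  simp only [ExtLt, hrk, sg] at *
  cases i <;> cases j <;> cases k <;> cases l <;> simp at h1 h2 h3 ⊢ <;>
    split_ifs <;> first | decide | (exfalso; omega)

lemma sum_nocross {lt : Q → Q → Prop} {rk : Q → ℕ}
    (hrk : ∀ x y, lt x y ↔ rk x < rk y) (hinj : ∀ x y, rk x = rk y → x = y)
    {E : Q × Bool → Q × Bool → Prop}
    (hE : ¬ ∃ u r v s : Q × Bool, ExtLt lt u r ∧ ExtLt lt r v ∧ ExtLt lt v s ∧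
      (E u v ∨ E v u) ∧ (E r s ∨ E s r))
    {u r v s : Q × Bool} (huv : E u v) (hrs : E r s)
    (h1 : u ≠ r) (h2 : u ≠ s) (h3 : v ≠ r) (h4 : v ≠ s) :
    sg rk r u + sg rk r v + sg rk s u + sg rk s v = 0 := by
  push Not at hE
  have c1 := fun a b c => hE u r v s a b c (Or.inl huv)
  have c2 := fun a b c => hE u s v r a b c (Or.inl huv)
  have c3 := fun a b c => hE v r u s a b c (Or.inr huv)
  have c4 := fun a b c => hE v s u r a b c (Or.inr huv)
  have c5 := fun a b c => hE r u s v a b c (Or.inl hrs)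
  have c6 := fun a b c => hE r v s u a b c (Or.inl hrs)
  have c7 := fun a b c => hE s u r v a b c (Or.inr hrs)
  have c8 := fun a b c => hE s v r u a b c (Or.inr hrs)
  simp only [huv, hrs, not_true, imp_false, false_and, and_false] at c1 c2 c3 c4 c5 c6 c7 c8
  clear hE huv hrs
  obtain ⟨u, i⟩ := u
  obtain ⟨r, j⟩ := r
  obtain ⟨v, k⟩ := v
  obtain ⟨s, l⟩ := s
  have d1 : rk u = rk r → i ≠ j := fun h h' => h1 (by rw [hinj _ _ h, h'])
  have d2 : rk u = rk s → i ≠ l := fun h h' => h2 (by rw [hinj _ _ h, h'])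
  have d3 : rk v = rk r → k ≠ j := fun h h' => h3 (by rw [hinj _ _ h, h'])
  have d4 : rk v = rk s → k ≠ l := fun h h' => h4 (by rw [hinj _ _ h, h'])
  clear h1 h2 h3 h4
  simp only [ExtLt, hrk, sg] at *
  generalize rk u = a at *
  generalize rk r = b at *
  generalize rk v = c at *
  generalize rk s = d at *
  cases i <;> cases j <;> cases k <;> cases l <;> simp at c1 c2 c3 c4 c5 c6 c7 c8 d1 d2 d3 d4 ⊢ <;>
    split_ifs <;> first | decide | (exfalso; omega)

lemma exists_path {α : Type} {R : α → α → Prop} {x y : α} (h : ReflTransGen R x y) :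
    ∃ (L : ℕ) (v : ℕ → α), v 0 = x ∧ v L = y ∧ ∀ t < L, R (v t) (v (t + 1)) := by
  induction h with
  | refl => exact ⟨0, fun _ => x, rfl, rfl, by simp⟩
  | @tail y z _ hyz ih =>
    obtain ⟨L, v, h0, hL, hs⟩ := ih
    refine ⟨L + 1, fun t => if t ≤ L then v t else z, by simp [h0], by simp, ?_⟩
    intro t ht
    rcases Nat.lt_or_ge t L with h | h
    · have h1 : t ≤ L := by omega
      have h2 : t + 1 ≤ L := by omega
      simp only [h1, h2, if_true]
      exact hs t h
    · obtain rfl : t = L := by omega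
      simp [hL, hyz]

lemma path_reach {α : Type} {R : α → α → Prop} {L : ℕ} {v : ℕ → α}
    (hs : ∀ t < L, R (v t) (v (t + 1))) (t : ℕ) (ht : t ≤ L) : ReflTransGen R (v t) (v L) := by
  induction L with
  | zero => obtain rfl : t = 0 := by omega
            exact ReflTransGen.refl
  | succ L ih =>
    rcases Nat.lt_or_ge t (L + 1) with h | h
    · exact (ih (fun t ht => hs t (by omega)) (by omega)).tail (hs L (by omega))
    · obtain rfl : t = L + 1 := by omega
      exact ReflTransGen.refl

/-- Moving a strip vertex to the profile of cell `k`. -/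
def toB (k : ℕ) (x : Q × ℕ) : Q × Bool := (x.1, decide (x.2 = k + 1))

lemma sg_toB {rk : Q → ℕ} {k : ℕ} {x y : Q × ℕ} (hx : x.2 = k ∨ x.2 = k + 1)
    (hy : y.2 = k ∨ y.2 = k + 1) : sg rk (toB k x) (toB k y) = sg rk x y := by
  obtain ⟨x, i⟩ := x
  obtain ⟨y, j⟩ := y
  simp only [sg, toB] at *
  rcases hx with rfl | rfl <;> rcases hy with rfl | rfl <;> simp

lemma toB_inj {k : ℕ} {x y : Q × ℕ} (hx : x.2 = k ∨ x.2 = k + 1)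
    (hy : y.2 = k ∨ y.2 = k + 1) (h : toB k x = toB k y) : x = y := by
  obtain ⟨x, i⟩ := x
  obtain ⟨y, j⟩ := y
  simp only [toB, Prod.mk.injEq] at *
  obtain ⟨rfl, h⟩ := h
  rcases hx with rfl | rfl <;> rcases hy with rfl | rfl <;> simp at h ⊢

lemma src_or {ρ : Q → Bool} (q : Q) (k : ℕ) : srcGap ρ q k = k ∨ srcGap ρ q k = k + 1 := by
  unfold srcGap; split_ifs <;> simp

lemma tgt_or {ρ : Q → Bool} (q : Q) (k : ℕ) : tgtGap ρ q k = k ∨ tgtGap ρ q k = k + 1 := by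
  unfold tgtGap; split_ifs <;> simp

lemma profile_of_cell {ρ : Q → Bool} {f : Set (Q × Q)} {k : ℕ} {x y : Q × ℕ}
    (h : (x.1, y.1) ∈ f) (hx : x.2 = srcGap ρ x.1 k) (hy : y.2 = tgtGap ρ y.1 k) :
    ProfileEdge ρ f (toB k x) (toB k y) := by
  refine ⟨_, h, ?_, ?_⟩
  · simp only [toB, hx, srcGap]
    cases ρ x.1 <;> simp
  · simp only [toB, hy, tgtGap]
    cases ρ y.1 <;> simp

lemma sum_range_telescope (α β : ℕ → ZMod 2) (L : ℕ) (h : ∀ t < L, α t = β (t + 1)) :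
    ∑ t ∈ Finset.range (L + 1), (α t + β t) = α L + β 0 := by
  rw [Finset.sum_add_distrib, Finset.sum_range_succ, Finset.sum_range_succ',
    Finset.sum_congr rfl (fun t ht => h t (Finset.mem_range.1 ht))]
  have : ∀ x y z : ZMod 2, x + y + (x + z) = y + z := by decide
  exact this _ _ _

/-- One step of a run disjoint from a given path does not change the parity. -/
lemma parity_step {lt : Q → Q → Prop} {rk : Q → ℕ} {ρ : Q → Bool} {c : ℕ → Set (Q × Q)} {a b : ℕ}
    (hrk : ∀ x y, lt x y ↔ rk x < rk y) (hinj : ∀ x y, rk x = rk y → x = y)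
    (hp : ∀ k, IsPlanar ρ lt (c k))
    {L : ℕ} {v : ℕ → Q × ℕ} (hv : ∀ t < L, SStep ρ c a b (v t) (v (t + 1)))
    (h0 : (v 0).2 = if ρ (v 0).1 then a else b) (hL : (v L).2 = if ρ (v L).1 then b else a)
    {w w' : Q × ℕ} (hw : SStep ρ c a b w w')
    (hd : ∀ t ≤ L, v t ≠ w ∧ v t ≠ w') :
    ∑ t ∈ Finset.range (L + 1), sg rk w (v t) = ∑ t ∈ Finset.range (L + 1), sg rk w' (v t) := by
  obtain ⟨k, hk1, hk2, hww, hw1, hw2⟩ := hw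
  have hwk : w.2 = k ∨ w.2 = k + 1 := hw1 ▸ src_or _ _
  have hwk' : w'.2 = k ∨ w'.2 = k + 1 := hw2 ▸ tgt_or _ _
  let φ : Q × ℕ → ZMod 2 := fun x => sg rk w x + sg rk w' x
  let α : ℕ → ZMod 2 := fun t => if (v t).2 = srcGap ρ (v t).1 k then φ (v t) else 0
  let β : ℕ → ZMod 2 := fun t => if (v t).2 = tgtGap ρ (v t).1 k then φ (v t) else 0
  have hsum : ∑ t ∈ Finset.range (L + 1), φ (v t) = α L + β 0 := by
    rw [← sum_range_telescope α β L]
    · refine Finset.sum_congr rfl fun t _ => ?_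
      simp only [α, β, srcGap, tgtGap]
      by_cases hk : (v t).2 = k
      · by_cases hq : ρ (v t).1 = true <;> simp [hk, hq]
      · by_cases hk' : (v t).2 = k + 1
        · by_cases hq : ρ (v t).1 = true <;> simp [hk', hq]
        · have e1 : φ (v t) = 0 := by
            simp only [φ, sg]
            rw [if_neg, if_neg]
            · simp
            · rintro ⟨e, _⟩; omega
            · rintro ⟨e, _⟩; omega
          simp [e1]
    · intro t ht
      obtain ⟨l, hl1, hl2, hvv, hv1, hv2⟩ := hv t ht
      by_cases hlk : l = k
      · subst hlk
        simp only [α, β]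
        rw [if_pos hv1, if_pos hv2]
        have hvk : (v t).2 = l ∨ (v t).2 = l + 1 := hv1 ▸ src_or _ _
        have hvk' : (v (t+1)).2 = l ∨ (v (t+1)).2 = l + 1 := hv2 ▸ tgt_or _ _
        have := sum_nocross hrk hinj (hp l) (profile_of_cell hvv hv1 hv2)
          (profile_of_cell hww hw1 hw2)
          (fun h => (hd t (by omega)).1 (toB_inj hvk hwk h))
          (fun h => (hd t (by omega)).2 (toB_inj hvk hwk' h))
          (fun h => (hd (t+1) (by omega)).1 (toB_inj hvk' hwk h))
          (fun h => (hd (t+1) (by omega)).2 (toB_inj hvk' hwk' h))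
        rw [sg_toB hwk hvk, sg_toB hwk hvk', sg_toB hwk' hvk, sg_toB hwk' hvk'] at this
        simp only [φ]
        have e : ∀ x y z t : ZMod 2, x + y + z + t = 0 → x + z = y + t := by decide
        exact e _ _ _ _ this
      · simp only [α, β]
        rw [if_neg, if_neg]
        · intro e
          simp only [tgtGap] at hv2 e
          split_ifs at hv2 e <;> omega
        · intro e
          simp only [srcGap] at hv1 e
          split_ifs at hv1 e <;> omega
  have e1 : α L = 0 := by
    simp only [α]
    rw [if_neg]
    intro e
    simp only [srcGap] at e
    split_ifs at e hL <;> omega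
  have e2 : β 0 = 0 := by
    simp only [β]
    rw [if_neg]
    intro e
    simp only [tgtGap] at e
    split_ifs at e h0 <;> omega
  rw [e1, e2, Finset.sum_add_distrib] at hsum
  have e : ∀ x y : ZMod 2, x + y = 0 + 0 → x = y := by decide
  exact e _ _ hsum

/-- Outer vertices only see the two end points of a path. -/
lemma outer_sum {rk : Q → ℕ} {ρ : Q → Bool} {c : ℕ → Set (Q × Q)} {a b : ℕ} (hab : a < b)
    {L : ℕ} {v : ℕ → Q × ℕ} (hv : ∀ t < L, SStep ρ c a b (v t) (v (t + 1)))
    (h0 : (v 0).2 = if ρ (v 0).1 then a else b) (hL : (v L).2 = if ρ (v L).1 then b else a)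
    {w : Q × ℕ} (hw : w.2 = a ∨ w.2 = b) :
    ∑ t ∈ Finset.range (L + 1), sg rk w (v t) = sg rk w (v 0) + sg rk w (v L) := by
  rcases L with _ | L
  · exfalso
    split_ifs at h0 hL <;> omega
  · rw [Finset.sum_range_succ, Finset.sum_range_succ', Finset.sum_eq_zero, zero_add]
    intro t ht
    rw [Finset.mem_range] at ht
    obtain ⟨k, h1, h2, -, -, h3⟩ := hv t (by omega)
    obtain ⟨k', h1', h2', -, h3', -⟩ := hv (t + 1) (by omega)
    simp only [sg]
    rw [if_neg]
    rintro ⟨e, -⟩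
    simp only [srcGap, tgtGap] at h3 h3'
    split_ifs at h3 h3' <;> omega

/-- The two ends of disjoint runs do not cross, in parity form. -/
lemma str_parity {lt : Q → Q → Prop} {rk : Q → ℕ} {ρ : Q → Bool} {c : ℕ → Set (Q × Q)} {a b : ℕ}
    (hrk : ∀ x y, lt x y ↔ rk x < rk y) (hinj : ∀ x y, rk x = rk y → x = y) (hab : a < b)
    (hdet : ∀ k, IsDet (c k)) (hp : ∀ k, IsPlanar ρ lt (c k)) {u v r s : Q × Bool}
    (huv : ProfileEdge ρ (Str ρ c a b) u v) (hrs : ProfileEdge ρ (Str ρ c a b) r s)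
    (hvs : v ≠ s) : sg rk r u + sg rk r v + sg rk s u + sg rk s v = 0 := by
  obtain ⟨⟨u, v⟩, huv, rfl, rfl⟩ := huv
  obtain ⟨⟨r, s⟩, hrs, rfl, rfl⟩ := hrs
  simp only at hvs
  have hvs' : v ≠ s := fun h => hvs (by rw [h])
  obtain ⟨L, p, hp0, hpL, hps⟩ := exists_path huv
  simp only at hp0 hpL
  have h0 : (p 0).2 = if ρ (p 0).1 then a else b := by rw [hp0]
  have hL : (p L).2 = if ρ (p L).1 then b else a := by rw [hpL]
  have inv : ∀ w, ReflTransGen (SStep ρ c a b) w (s, if ρ s then b else a) →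
      ∑ t ∈ Finset.range (L + 1), sg rk w (p t) =
      ∑ t ∈ Finset.range (L + 1), sg rk (s, if ρ s then b else a) (p t) := by
    have hdisj : ∀ w, ReflTransGen (SStep ρ c a b) w (s, if ρ s then b else a) →
        ∀ t ≤ L, p t ≠ w := by
      rintro w hw t ht rfl
      have := path_reach hps t ht
      rw [hpL] at this
      exact hvs' (sstep_end_unique hdet this hw)
    intro w hw
    induction hw using ReflTransGen.head_induction_on with
    | refl => rfl
    | @head w w' h h' ih =>
      rw [← ih]
      exact parity_step hrk hinj hp hps h0 hL h
        (fun t ht => ⟨hdisj _ (h'.head h) t ht, hdisj _ h' t ht⟩)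
  have := inv _ hrs
  simp only at this
  rw [outer_sum hab hps h0 hL (by simp only; split_ifs <;> simp),
    outer_sum hab hps h0 hL (by simp only; split_ifs <;> simp), hp0, hpL] at this
  have e : ∀ x y z t : ZMod 2, x + y = z + t → x + y + z + t = 0 := by decide
  have key := e _ _ _ _ this
  have hne : a ≠ b := by omega
  rw [← key]
  simp only [sg]
  cases ρ u <;> cases ρ v <;> cases ρ r <;> cases ρ s <;> simp [hne, hne.symm]

lemma extLt_ne {lt : Q → Q → Prop} {rk : Q → ℕ}
    (hrk : ∀ x y, lt x y ↔ rk x < rk y) {u v : Q × Bool} (h : ExtLt lt u v) : u ≠ v := by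
  rintro rfl
  simp only [ExtLt, hrk] at h
  cases hu : u.2 <;> simp [hu] at h

lemma extLt_trans {lt : Q → Q → Prop} {rk : Q → ℕ}
    (hrk : ∀ x y, lt x y ↔ rk x < rk y) {u v w : Q × Bool} (h : ExtLt lt u v)
    (h' : ExtLt lt v w) : ExtLt lt u w := by
  simp only [ExtLt, hrk] at *
  cases hu : u.2 <;> cases hv : v.2 <;> cases hw : w.2 <;> simp [hu, hv, hw] at h h' ⊢ <;> omega

lemma str_planar [Fintype Q] {lt : Q → Q → Prop} [IsStrictTotalOrder Q lt] {ρ : Q → Bool}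
    {c : ℕ → Set (Q × Q)} {a b : ℕ} (hab : a < b)
    (hdet : ∀ k, IsDet (c k)) (hp : ∀ k, IsPlanar ρ lt (c k)) : IsPlanar ρ lt (Str ρ c a b) := by
  obtain ⟨rk, hrk⟩ := exists_rank lt
  have hinj : ∀ x y, rk x = rk y → x = y := fun x y h => rank_inj hrk h
  rintro ⟨u, r, v, s, h1, h2, h3, huv, hrs⟩
  have n1 := (extLt_ne hrk h1)
  have n2 := (extLt_ne hrk h2).symm
  have n3 := (extLt_ne hrk h3)
  have n4 := extLt_ne hrk (extLt_trans hrk (extLt_trans hrk h1 h2) h3)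
  apply sum_cross hrk h1 h2 h3
  rcases huv with huv | huv <;> rcases hrs with hrs | hrs
  · exact str_parity hrk hinj hab hdet hp huv hrs n3
  · have := str_parity hrk hinj hab hdet hp huv hrs n2
    rw [← this]; ring
  · have := str_parity hrk hinj hab hdet hp huv hrs n4
    rw [← this]; ring
  · have := str_parity hrk hinj hab hdet hp huv hrs n1
    rw [← this]; ring

lemma glue_det_planar [Fintype Q] {lt : Q → Q → Prop} [IsStrictTotalOrder Q lt] {ρ : Q → Bool}
    {f g : Set (Q × Q)} (hf : IsDet f) (hf' : IsPlanar ρ lt f) (hg : IsDet g)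
    (hg' : IsPlanar ρ lt g) : IsDet (glue ρ f g) ∧ IsPlanar ρ lt (glue ρ f g) := by
  rw [glue_eq_str]
  refine ⟨str_det fun k => ?_, str_planar (by omega) (fun k => ?_) (fun k => ?_)⟩ <;>
    split_ifs <;> assumption

lemma id_det : IsDet (idRel Q) := by
  intro q r r' h h'
  exact Eq.trans (Eq.symm h) h'

lemma id_planar [Fintype Q] {lt : Q → Q → Prop} [IsStrictTotalOrder Q lt] {ρ : Q → Bool} :
    IsPlanar ρ lt (idRel Q) := by
  obtain ⟨rk, hrk⟩ := exists_rank lt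
  have key : ∀ u v, ProfileEdge ρ (idRel Q) u v ∨ ProfileEdge ρ (idRel Q) v u →
      u.1 = v.1 ∧ u.2 = !v.2 := by
    rintro u v (⟨⟨p, q⟩, h, rfl, rfl⟩ | ⟨⟨p, q⟩, h, rfl, rfl⟩) <;>
    · obtain rfl : p = q := h
      simp
  rintro ⟨u, r, v, s, h1, h2, h3, huv, hrs⟩
  obtain ⟨e1, e2⟩ := key _ _ huv
  obtain ⟨e3, e4⟩ := key _ _ hrs
  simp only [ExtLt, hrk, e1, e2, e3, e4] at h1 h2 h3
  cases hv : v.2 <;> cases hs : s.2 <;> simp [hv, hs] at h1 h2 h3 <;> omega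

lemma planar_mirror {lt : Q → Q → Prop} {ρ : Q → Bool} {f : Set (Q × Q)}
    (h : IsPlanar ρ lt f) : IsPlanar (fun q => !ρ q) lt f := by
  rintro ⟨u, r, v, s, h1, h2, h3, huv, hrs⟩
  have hx : ∀ x y : Q × Bool, ExtLt lt x y → ExtLt lt (y.1, !y.2) (x.1, !x.2) := by
    intro x y h
    simp only [ExtLt] at h ⊢
    cases hx : x.2 <;> cases hy : y.2 <;> simp [hx, hy] at h ⊢ <;> assumption
  have he : ∀ x y : Q × Bool, ProfileEdge (fun q => !ρ q) f x y →
      ProfileEdge ρ f (x.1, !x.2) (y.1, !y.2) := by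
    rintro x y ⟨p, hp, rfl, rfl⟩
    exact ⟨p, hp, by simp, by simp⟩
  exact h ⟨_, _, _, _, hx _ _ h3, hx _ _ h2, hx _ _ h1,
    hrs.symm.imp (he _ _) (he _ _), huv.symm.imp (he _ _) (he _ _)⟩

end Planarity

section Aperiodic

open Relation

variable {Q : Type}

/-- The right-right part of a transition. -/
def RRpart (ρ : Q → Bool) (X : Set (Q × Q)) : Set (Q × Q) :=
  {p | p ∈ X ∧ ρ p.1 = false ∧ ρ p.2 = true}

lemma glueEdge_mono {ρ : Q → Bool} {X X' Y : Set (Q × Q)} (h : X ⊆ X') {x y : Q × Fin 3}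
    (e : GlueEdge ρ X Y x y) : GlueEdge ρ X' Y x y := by
  rcases e with ⟨h1, h2, p, hp, h3⟩ | e
  · exact Or.inl ⟨h1, h2, p, h hp, h3⟩
  · exact Or.inr e

lemma glueEdge_not_exit {ρ : Q → Bool} {X Y : Set (Q × Q)} {z : Q} {y : Q × Fin 3}
    (hz : ρ z = false) : ¬ GlueEdge ρ X Y (z, 0) y := by
  intro h
  rcases glueEdge_cases h with ⟨-, h, -⟩ | ⟨-, h, -⟩ <;> simp [hz] at h

lemma restrict_path {ρ : Q → Bool} {X Y : Set (Q × Q)} {r : Q} {z : Q × Fin 3}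
    (h : ReflTransGen (GlueEdge ρ X Y) z (r, 2)) (hz : z.2 ≠ 0) :
    ReflTransGen (GlueEdge ρ (RRpart ρ X) Y) z (r, 2) := by
  induction h using ReflTransGen.head_induction_on with
  | refl => exact ReflTransGen.refl
  | @head z z' hzz' h' ih =>
    obtain ⟨z, i⟩ := z
    obtain ⟨z', j⟩ := z'
    simp only at hz ih
    rcases glueEdge_cases hzz' with ⟨h1, h2, h3⟩ | ⟨h1, h2, h3⟩
    · simp only at h1 h2 h3
      cases hρ : ρ z
      · cases hρ' : ρ z'
        · simp [hρ'] at h3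
          subst h3
          rcases h'.cases_head with e | ⟨y, e, _⟩
          · simp at e
          · exact absurd e (glueEdge_not_exit hρ')
        · have : (z, z') ∈ RRpart ρ X := ⟨h1, hρ, hρ'⟩
          have e := glueEdge_left (ρ := ρ) (Y := Y) this
          rw [← h2, ← h3] at e
          refine (ih ?_).head e
          simp [h3, hρ']
      · simp [hρ] at h2; exact absurd h2 hz
    · simp only at h1 h2 h3
      have e := glueEdge_right (ρ := ρ) (X := RRpart ρ X) h1
      rw [← h2, ← h3] at e
      refine (ih ?_).head e
      rw [h3]; split_ifs <;> decide

lemma glue_LR {ρ : Q → Bool} {X Y : Set (Q × Q)} {q r : Q} (hq : ρ q = true) (hr : ρ r = true) :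
    (q, r) ∈ glue ρ X Y ↔ ∃ s, ρ s = true ∧ (q, s) ∈ X ∧
      ReflTransGen (GlueEdge ρ (RRpart ρ X) Y) (s, 1) (r, 2) := by
  have unf : (q, r) ∈ glue ρ X Y ↔ ReflTransGen (GlueEdge ρ X Y) (q, 0) (r, 2) := by
    simp [glue, hq, hr]
  rw [unf]
  constructor
  · intro h
    rcases h.cases_head with h | ⟨⟨s, j⟩, h, h'⟩
    · simp at h
    · rcases glueEdge_cases h with ⟨h1, h2, h3⟩ | ⟨h1, h2, h3⟩
      · simp only at h1 h2 h3
        cases hρ : ρ s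
        · simp [hρ] at h3
          subst h3
          rcases h'.cases_head with e | ⟨y, e, _⟩
          · simp at e
          · exact absurd e (glueEdge_not_exit hρ)
        · simp [hρ] at h3
          subst h3
          exact ⟨s, hρ, h1, restrict_path h' (by simp)⟩
      · simp [hq] at h2
  · rintro ⟨s, hs, h1, h2⟩
    have e := glueEdge_left (ρ := ρ) (Y := Y) h1
    simp only [hq, hs, if_true] at e
    exact (ReflTransGen.mono (fun _ _ => glueEdge_mono (fun p hp => hp.1)) _ _ h2).head e

lemma glue_LR_image {ρ : Q → Bool} {X Y : Set (Q × Q)} {q r : Q} (hq : ρ q = true)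
    (hr : ρ r = true) (h : (q, r) ∈ glue ρ X Y) : ∃ t, ρ t = true ∧ (t, r) ∈ Y := by
  have h : ReflTransGen (GlueEdge ρ X Y) (q, 0) (r, 2) := by
    simpa [glue, hq, hr] using h
  rcases h.cases_tail with h | ⟨⟨t, i⟩, h, e⟩
  · simp at h
  · rcases glueEdge_cases e with ⟨h1, h2, h3⟩ | ⟨h1, h2, h3⟩
    · simp [hr] at h3
    · simp only at h1 h2 h3
      cases hρ : ρ t
      · exfalso
        simp [hρ] at h2
        subst h2
        rcases h.cases_tail with h | ⟨⟨y, j⟩, -, e'⟩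
        · simp at h
        · rcases glueEdge_cases e' with ⟨-, -, h3⟩ | ⟨-, -, h3⟩ <;> simp [hρ] at h3
      · exact ⟨t, hρ, h1⟩

lemma glue_RR {ρ : Q → Bool} {X Y : Set (Q × Q)} {q r : Q} (hq : ρ q = false) (hr : ρ r = true)
    (h : (q, r) ∈ Y) : (q, r) ∈ glue ρ X Y := by
  have e := glueEdge_right (ρ := ρ) (X := X) h
  simp only [hq, hr, if_true] at e
  have := ReflTransGen.single e
  simpa [glue, hq, hr] using this

/-- Left-to-right parts of deterministic planar transitions are order preserving. -/
lemma planar_mono [LinearOrder Q] {ρ : Q → Bool} {F : Set (Q × Q)}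
    (hp : IsPlanar ρ (fun x y : Q => x < y) F)
    {q q' s s' : Q} (hq : ρ q = true) (hq' : ρ q' = true) (hs : ρ s = true) (hs' : ρ s' = true)
    (h : (q, s) ∈ F) (h' : (q', s') ∈ F) (hlt : q < q') : s ≤ s' := by
  by_contra hc
  push Not at hc
  refine hp ⟨(q', false), (q, false), (s', true), (s, true), ?_, ?_, ?_, Or.inl ?_, Or.inl ?_⟩
  · simp [ExtLt, hlt]
  · simp [ExtLt]
  · simp [ExtLt, hc]
  · exact ⟨_, h', by simp [hq'], by simp [hs']⟩
  · exact ⟨_, h, by simp [hq], by simp [hs]⟩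

lemma planar_mono_inv [LinearOrder Q] {ρ : Q → Bool} {F : Set (Q × Q)}
    (hd : IsDet F) (hp : IsPlanar ρ (fun x y : Q => x < y) F)
    {q q' s s' : Q} (hq : ρ q = true) (hq' : ρ q' = true) (hs : ρ s = true) (hs' : ρ s' = true)
    (h : (q, s) ∈ F) (h' : (q', s') ∈ F) (hlt : s < s') : q < q' := by
  rcases lt_trichotomy q q' with h1 | rfl | h1
  · exact h1
  · exact absurd (hd _ _ _ h h') hlt.ne
  · exact absurd (planar_mono hp hq' hq hs' hs h' h h1) (not_le.2 hlt)

lemma stab_orbit [LinearOrder Q] [Fintype Q] {ρ : Q → Bool} {f : Set (Q × Q)}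
    {F : ℕ → Set (Q × Q)}
    (h1 : ∀ n, F (n + 1) = glue ρ (F n) f) (h2 : ∀ n, F (n + 1) = glue ρ f (F n))
    (hd : ∀ n, IsDet (F n)) (hp : ∀ n, IsPlanar ρ (fun x y : Q => x < y) (F n))
    (hRR : ∀ n, RRpart ρ (F n) = RRpart ρ (F 0)) (q : Q) (hq : ρ q = true) :
    ∃ N, ∀ n ≥ N, ∀ r, ρ r = true → ((q, r) ∈ F n ↔ (q, r) ∈ F N) := by
  have hG : ∀ n q r, ρ q = true → ρ r = true → ((q, r) ∈ F (n + 1) ↔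
      ∃ s, ρ s = true ∧ (q, s) ∈ F n ∧
        ReflTransGen (GlueEdge ρ (RRpart ρ (F 0)) f) (s, 1) (r, 2)) := by
    intro n q r hq hr
    rw [h1, glue_LR hq hr, hRR]
  by_cases hdef : ∀ n, ∃ s, ρ s = true ∧ (q, s) ∈ F n
  · choose s hs hqs using hdef
    have hGs : ∀ n, ReflTransGen (GlueEdge ρ (RRpart ρ (F 0)) f) (s n, 1) (s (n + 1), 2) := by
      intro n
      obtain ⟨t, ht, hqt, hG'⟩ := (hG n q (s (n + 1)) hq (hs _)).1 (hqs _)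
      rwa [hd n _ _ _ (hqs n) hqt]
    have himg : ∀ n, ∃ p, ρ p = true ∧ (p, s (n + 1)) ∈ F n := by
      intro n
      have := hqs (n + 1)
      rw [h2] at this
      exact glue_LR_image hq (hs _) this
    have heq : ∀ n, s n = s (n + 1) → s (n + 1) = s (n + 2) := by
      intro n e
      have : (q, s (n + 2)) ∈ F (n + 1) :=
        (hG n q _ hq (hs _)).2 ⟨s n, hs _, hqs _, by rw [e]; exact hGs (n + 1)⟩
      exact hd _ _ _ _ (hqs _) this
    have hle : ∀ n, s n ≤ s (n + 1) → s (n + 1) ≤ s (n + 2) := by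
      intro n h
      rcases h.eq_or_lt with e | e
      · exact (heq n e).le
      · obtain ⟨p, hρ, hps⟩ := himg n
        have l := planar_mono_inv (hd n) (hp n) hq hρ (hs _) (hs _) (hqs n) hps e
        have : (p, s (n + 2)) ∈ F (n + 1) :=
          (hG n p _ hρ (hs _)).2 ⟨_, hs _, hps, hGs (n + 1)⟩
        exact planar_mono (hp (n + 1)) hq hρ (hs _) (hs _) (hqs _) this l
    have hge : ∀ n, s (n + 1) ≤ s n → s (n + 2) ≤ s (n + 1) := by
      intro n h
      rcases h.eq_or_lt with e | e
      · exact (heq n e.symm).ge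
      · obtain ⟨p, hρ, hps⟩ := himg n
        have l := planar_mono_inv (hd n) (hp n) hρ hq (hs _) (hs _) hps (hqs n) e
        have : (p, s (n + 2)) ∈ F (n + 1) :=
          (hG n p _ hρ (hs _)).2 ⟨_, hs _, hps, hGs (n + 1)⟩
        exact planar_mono (hp (n + 1)) hρ hq (hs _) (hs _) this (hqs _) l
    have hst : ∃ N, ∀ n, N ≤ n → s N = s n := by
      rcases le_total (s 0) (s 1) with h | h
      · have m : Monotone s := monotone_nat_of_le_succ (fun n => by
          induction n with
          | zero => exact h
          | succ n ih => exact hle n ih)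
        exact WellFoundedGT.monotone_chain_condition (⟨s, m⟩ : ℕ →o Q)
      · have m : Monotone (fun n => OrderDual.toDual (s n)) := monotone_nat_of_le_succ (fun n => by
          rw [OrderDual.toDual_le_toDual]
          induction n with
          | zero => exact h
          | succ n ih => exact hge n ih)
        obtain ⟨N, hN⟩ := WellFoundedGT.monotone_chain_condition
          (⟨fun n => OrderDual.toDual (s n), m⟩ : ℕ →o Qᵒᵈ)
        exact ⟨N, fun n hn => OrderDual.toDual.injective (hN n hn)⟩
    obtain ⟨N, hN⟩ := hst
    refine ⟨N, fun n hn r hr => ⟨fun h => ?_, fun h => ?_⟩⟩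
    · rw [hd n _ _ _ h (hqs n), ← hN n hn]; exact hqs N
    · rw [hd N _ _ _ h (hqs N), hN n hn]; exact hqs n
  · push Not at hdef
    obtain ⟨N, hN⟩ := hdef
    have : ∀ n ≥ N, ∀ s, ρ s = true → (q, s) ∉ F n := by
      intro n hn
      induction n, hn using Nat.le_induction with
      | base => exact hN
      | succ n hn ih =>
        intro s hs h
        obtain ⟨t, ht, hqt, -⟩ := (hG n q s hq hs).1 h
        exact ih t ht hqt
    exact ⟨N, fun n hn r hr => iff_of_false (this n hn r hr) (hN r hr)⟩

lemma stab_right [LinearOrder Q] [Fintype Q] {ρ : Q → Bool} {f : Set (Q × Q)}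
    {F : ℕ → Set (Q × Q)}
    (h1 : ∀ n, F (n + 1) = glue ρ (F n) f) (h2 : ∀ n, F (n + 1) = glue ρ f (F n))
    (hd : ∀ n, IsDet (F n)) (hp : ∀ n, IsPlanar ρ (fun x y : Q => x < y) (F n)) :
    ∃ N, ∀ n ≥ N, ∀ q r, ρ r = true → ((q, r) ∈ F n ↔ (q, r) ∈ F N) := by
  have m : Monotone (fun n => RRpart ρ (F n)) := monotone_nat_of_le_succ (fun n => by
    rintro ⟨q, r⟩ ⟨h, hq, hr⟩
    refine ⟨?_, hq, hr⟩
    rw [h2]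
    exact glue_RR hq hr h)
  obtain ⟨N, hN⟩ := WellFoundedGT.monotone_chain_condition
    (⟨fun n => RRpart ρ (F n), m⟩ : ℕ →o Set (Q × Q))
  have hN : ∀ n ≥ N, RRpart ρ (F N) = RRpart ρ (F n) := hN
  have orb : ∀ q, ∃ M, ρ q = true → ∀ n ≥ M, ∀ r, ρ r = true →
      ((q, r) ∈ F (N + n) ↔ (q, r) ∈ F (N + M)) := by
    intro q
    by_cases hq : ρ q = true
    · obtain ⟨M, hM⟩ := stab_orbit (F := fun n => F (N + n)) (fun n => h1 (N + n))
        (fun n => h2 (N + n)) (fun n => hd _) (fun n => hp _)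
        (fun n => (hN (N + n) (by omega)).symm) q hq
      exact ⟨M, fun _ => hM⟩
    · exact ⟨0, fun h => absurd h hq⟩
  choose M hM using orb
  refine ⟨N + Finset.univ.sup M, fun n hn q r hr => ?_⟩
  obtain ⟨d, rfl⟩ := Nat.exists_eq_add_of_le (le_trans (Nat.le_add_right _ _) hn)
  cases hq : ρ q
  · have e1 := hN (N + d) (by omega)
    have e2 := hN (N + Finset.univ.sup M) (by omega)
    have : (q, r) ∈ RRpart ρ (F (N + d)) ↔ (q, r) ∈ RRpart ρ (F (N + Finset.univ.sup M)) := by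
      rw [← e1, e2]
    have e3 : ∀ X, (q, r) ∈ RRpart ρ X ↔ (q, r) ∈ X := fun X =>
      ⟨fun h => h.1, fun h => ⟨h, hq, hr⟩⟩
    rwa [e3, e3] at this
  · have hs : M q ≤ Finset.univ.sup M := Finset.le_sup (Finset.mem_univ q)
    rw [hM q hq d (by omega) r hr, hM q hq _ hs r hr]

lemma glpow_stab [LinearOrder Q] [Fintype Q] {ρ : Q → Bool} {f : Set (Q × Q)}
    (hf : IsDet f) (hf' : IsPlanar ρ (fun x y : Q => x < y) f) :
    ∃ N, ∀ n ≥ N, glpow ρ f n = glpow ρ f N := by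
  have hdp : ∀ n, IsDet (glpow ρ f n) ∧ IsPlanar ρ (fun x y : Q => x < y) (glpow ρ f n) := by
    intro n
    induction n with
    | zero => exact ⟨id_det, id_planar⟩
    | succ n ih => exact glue_det_planar ih.1 ih.2 hf hf'
  obtain ⟨N1, hN1⟩ := stab_right (F := glpow ρ f) (fun n => rfl) (fun n => glpow_succ' f n)
    (fun n => (hdp n).1) (fun n => (hdp n).2)
  obtain ⟨N2, hN2⟩ := stab_right (ρ := fun q => !ρ q) (F := glpow ρ f) (f := f)
    (fun n => by rw [glue_mirror]; exact glpow_succ' f n)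
    (fun n => by rw [glue_mirror]; rfl)
    (fun n => (hdp n).1) (fun n => planar_mirror (hdp n).2)
  refine ⟨max N1 N2, fun n hn => ?_⟩
  ext ⟨q, r⟩
  cases hr : ρ r
  · rw [hN2 n (by omega) q r (by simp [hr]), hN2 (max N1 N2) (by omega) q r (by simp [hr])]
  · rw [hN1 n (by omega) q r hr, hN1 (max N1 N2) (by omega) q r hr]

end Aperiodic

/-- for a directed set of states `(Q, ρ)` and a total order on
`Q`, the deterministic planar transitions form a submonoid of `B(Q, ρ)`
(they contain the unit and are closed under gluing composition), and this
submonoid is aperiodic. -/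
theorem tlmon_submonoid_aperiodic {Q : Type} [Fintype Q] (ρ : Q → Bool)
    (lt : Q → Q → Prop) [IsStrictTotalOrder Q lt] :
    (IsDet (idRel Q) ∧ IsPlanar ρ lt (idRel Q)) ∧
    (∀ f g : Set (Q × Q), IsDet f → IsPlanar ρ lt f → IsDet g → IsPlanar ρ lt g →
      IsDet (glue ρ f g) ∧ IsPlanar ρ lt (glue ρ f g)) ∧
    (∃ n : ℕ, ∀ f : Set (Q × Q), IsDet f → IsPlanar ρ lt f →
      glpow ρ f (n + 1) = glpow ρ f n) := by
  classical
  refine ⟨⟨id_det, id_planar⟩, fun f g hf hf' hg hg' => glue_det_planar hf hf' hg hg', ?_⟩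
  let inst : LinearOrder Q := linearOrderOfSTO lt
  have key : ∀ f : Set (Q × Q), ∃ N, IsDet f → IsPlanar ρ lt f →
      ∀ n ≥ N, glpow ρ f n = glpow ρ f N := by
    intro f
    by_cases h : IsDet f ∧ IsPlanar ρ lt f
    · obtain ⟨N, hN⟩ := glpow_stab (ρ := ρ) h.1 h.2
      exact ⟨N, fun _ _ => hN⟩
    · exact ⟨0, fun h1 h2 => absurd ⟨h1, h2⟩ h⟩
  choose N hN using key
  refine ⟨Finset.univ.sup N, fun f hf hf' => ?_⟩
  have hs : N f ≤ Finset.univ.sup N := Finset.le_sup (Finset.mem_univ f)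
  rw [hN f hf hf' _ hs, hN f hf hf' _ (by omega)]
end Planar2DFT
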